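/- arXiv:2502.20170 — 6 statements merged into one kernel-verified Lean document; each statement's English description precedes it below -/
import Mathlib

section
/- Let p ∈ (0,1], let {1,…,n} be partitioned into C nonempty clone groups, with c(i) denoting the group of index i and n_c the size of group c. Define the n×n matrix U by U_{ij} = n_{c(i)}^{−1/(p+1)} if c(i) = c(j) and U_{ij} = 0 otherwise. Then a point x in the probability simplex Δ^{n−1} maximizes the affinity entropy H_a^p(x) = (1/p)·[1 − Σ_{i=1}^n ((Ux)_i)^{p+1}] over Δ^{n−1} if and only if for every group c, the total mass Σ_{j : c(j)=c} x_j equals 1/C. -/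
open Finset in
/-- On the simplex, the power sum with exponent `q > 1` is smallest at the uniform vector. -/
theorem card_mul_rpow_le_sum_rpow {ι : Type*} [Fintype ι] [Nonempty ι] {q : ℝ} (hq : 1 < q)
    {w : ι → ℝ} (hw : w ∈ stdSimplex ℝ ι) :
    (Fintype.card ι : ℝ) * (1 / (Fintype.card ι : ℝ)) ^ q ≤ ∑ g, w g ^ q := by
  have hC : (0 : ℝ) < Fintype.card ι := by exact_mod_cast Fintype.card_pos
  have h := (strictConvexOn_rpow hq).convexOn.map_sum_le (t := univ)
    (w := fun _ : ι => 1 / (Fintype.card ι : ℝ)) (p := w) (fun _ _ => by positivity)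
    (by simp [hC.ne']) (fun g _ => hw.1 g)
  simp only [smul_eq_mul, ← mul_sum, hw.2, mul_one] at h
  rwa [one_div_mul_eq_div, le_div_iff₀' hC] at h

open Finset in
/-- On the simplex, the power sum with exponent `q > 1` is smallest only at the uniform vector. -/
theorem eq_uniform_of_sum_rpow_eq {ι : Type*} [Fintype ι] [Nonempty ι] {q : ℝ} (hq : 1 < q)
    {w : ι → ℝ} (hw : w ∈ stdSimplex ℝ ι)
    (h : ∑ g, w g ^ q = (Fintype.card ι : ℝ) * (1 / (Fintype.card ι : ℝ)) ^ q) (g : ι) :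
    w g = 1 / (Fintype.card ι : ℝ) := by
  have hC : (0 : ℝ) < Fintype.card ι := by exact_mod_cast Fintype.card_pos
  have h' := (strictConvexOn_rpow hq).map_sum_eq_iff (t := univ)
    (w := fun _ : ι => 1 / (Fintype.card ι : ℝ)) (p := w) (fun _ _ => by positivity)
    (by simp [hC.ne']) (fun g _ => hw.1 g)
  simp only [smul_eq_mul, ← mul_sum, hw.2, mul_one] at h'
  refine h'.1 ?_ g (mem_univ g)
  rw [h, one_div_mul_eq_div, mul_div_cancel_left₀ _ hC.ne']

open Finset in
/-- The group masses of a point of the simplex form a point of the simplex. -/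
theorem groupMass_mem_stdSimplex {ι κ : Type*} [Fintype ι] [Fintype κ] [DecidableEq κ]
    (c : ι → κ) {y : ι → ℝ} (hy : y ∈ stdSimplex ℝ ι) :
    (fun g => ∑ j ∈ univ.filter fun j => c j = g, y j) ∈ stdSimplex ℝ κ :=
  ⟨fun _ => sum_nonneg fun j _ => hy.1 j, by rw [sum_fiberwise, hy.2]⟩

open Finset in
/-- The power sum of `U y`, for the clone matrix `U`, is the power sum of the group masses. -/
theorem sum_clone_rpow {ι κ : Type*} [Fintype ι] [Fintype κ] [DecidableEq κ]
    {c : ι → κ} (hc : Function.Surjective c) {q : ℝ} (hq : 0 < q) {U : ι → ι → ℝ}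
    (hU : ∀ i j, U i j =
      if c i = c j then ((univ.filter fun k => c k = c i).card : ℝ) ^ (-(1 / q)) else 0)
    {y : ι → ℝ} (hy : ∀ i, 0 ≤ y i) :
    ∑ i, (∑ j, U i j * y j) ^ q = ∑ g, (∑ j ∈ univ.filter fun j => c j = g, y j) ^ q := by
  rw [← sum_fiberwise univ c]
  refine sum_congr rfl fun g _ => ?_
  obtain ⟨k, hk⟩ := hc g
  have hcard : (0 : ℝ) < (univ.filter fun k => c k = g).card := by
    exact_mod_cast card_pos.2 ⟨k, by simp [hk]⟩
  have hM : 0 ≤ ∑ j ∈ univ.filter fun j => c j = g, y j := sum_nonneg fun j _ => hy j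
  have hterm : ∀ i ∈ univ.filter fun i => c i = g, (∑ j, U i j * y j) ^ q =
      ((univ.filter fun k => c k = g).card : ℝ)⁻¹ *
        (∑ j ∈ univ.filter fun j => c j = g, y j) ^ q := by
    intro i hi
    have hi : c i = g := by simpa using hi
    have hrow : ∑ j, U i j * y j = ((univ.filter fun k => c k = g).card : ℝ) ^ (-(1 / q)) *
        ∑ j ∈ univ.filter fun j => c j = g, y j := by
      rw [sum_filter, mul_sum]
      refine sum_congr rfl fun j _ => ?_
      rw [hU, hi]
      by_cases h : c j = g
      · simp [h]
      · simp [h, Ne.symm h]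
    rw [hrow, Real.mul_rpow (Real.rpow_nonneg hcard.le _) hM, ← Real.rpow_mul hcard.le,
      neg_mul, one_div_mul_cancel hq.ne', Real.rpow_neg_one]
  rw [sum_congr rfl hterm, sum_const, nsmul_eq_mul, mul_inv_cancel_left₀ hcard.ne']

open Finset in
/-- Some point of the simplex gives every group the same mass. -/
theorem exists_mem_stdSimplex_groupMass_eq {ι κ : Type*} [Fintype ι] [Fintype κ] [Nonempty κ]
    [DecidableEq κ] {c : ι → κ} (hc : Function.Surjective c) :
    ∃ y ∈ stdSimplex ℝ ι, ∀ g,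
      ∑ j ∈ univ.filter (fun j => c j = g), y j = 1 / (Fintype.card κ : ℝ) := by
  have hmass : ∀ g, ∑ j ∈ univ.filter (fun j => c j = g),
      1 / (Fintype.card κ : ℝ) / ((univ.filter fun k => c k = c j).card : ℝ) =
        1 / (Fintype.card κ : ℝ) := by
    intro g
    obtain ⟨k, hk⟩ := hc g
    have hcard : (0 : ℝ) < (univ.filter fun k => c k = g).card := by
      exact_mod_cast card_pos.2 ⟨k, by simp [hk]⟩
    rw [sum_congr rfl (g := fun _ => 1 / (Fintype.card κ : ℝ) /
      ((univ.filter fun k => c k = g).card : ℝ)) fun j hj => by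
        rw [(mem_filter.1 hj).2]]
    rw [sum_const, nsmul_eq_mul, mul_div_cancel₀ _ hcard.ne']
  refine ⟨_, ⟨fun j => by positivity, ?_⟩, hmass⟩
  rw [← sum_fiberwise univ c, sum_congr rfl fun g _ => hmass g]
  simp


/-- Let `p ∈ (0,1]`, let `{1,…,n}` be partitioned into `C` nonempty clone
groups via a surjective map `c : Fin n → Fin C`, with `n_c` the size of group `c`, and define
`U i j = n_{c(i)}^(-1/(p+1))` if `c i = c j` and `0` otherwise. Then `x` in the probability
simplex maximizes the affinity entropy `H_a^p` over the simplex iff every clone group carries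
total mass `1/C`. -/
theorem stmt_5 (n C : ℕ) (p : ℝ) (hp : p ∈ Set.Ioc (0 : ℝ) 1)
    (c : Fin n → Fin C) (hc : Function.Surjective c)
    (U : Fin n → Fin n → ℝ)
    (hUdef : ∀ i j, U i j =
      if c i = c j then
        (((Finset.univ.filter fun k => c k = c i).card : ℝ)) ^ (-(1 / (p + 1)))
      else 0)
    (x : Fin n → ℝ) (hx : x ∈ stdSimplex ℝ (Fin n)) :
    (∀ y ∈ stdSimplex ℝ (Fin n),
        (1 / p) * (1 - ∑ i, (∑ j, U i j * y j) ^ (p + 1)) ≤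
          (1 / p) * (1 - ∑ i, (∑ j, U i j * x j) ^ (p + 1))) ↔
      ∀ g : Fin C, ∑ j ∈ Finset.univ.filter fun j => c j = g, x j = 1 / (C : ℝ) := by
  have hq : 1 < p + 1 := by linarith [hp.1]
  have hp' : 0 < 1 / p := one_div_pos.2 hp.1
  have hC : Nonempty (Fin C) := by
    by_contra h
    have : IsEmpty (Fin n) := ⟨fun i => h ⟨c i⟩⟩
    simpa using hx.2
  have hsum := fun {y : Fin n → ℝ} (hy : y ∈ stdSimplex ℝ (Fin n)) =>
    sum_clone_rpow hc (by linarith) hUdef hy.1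
  have hle := fun {y : Fin n → ℝ} (hy : y ∈ stdSimplex ℝ (Fin n)) =>
    card_mul_rpow_le_sum_rpow hq (groupMass_mem_stdSimplex c hy)
  constructor
  · intro hmax
    obtain ⟨y, hy, hyg⟩ := exists_mem_stdSimplex_groupMass_eq hc
    have h := le_of_mul_le_mul_left (hmax y hy) hp'
    rw [hsum hx, hsum hy, Finset.sum_congr rfl fun g _ => by rw [hyg g]] at h
    rw [Finset.sum_const, Finset.card_univ, nsmul_eq_mul] at h
    simpa using eq_uniform_of_sum_rpow_eq hq (groupMass_mem_stdSimplex c hx)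
      (le_antisymm (by linarith) (hle hx))
  · intro hxg y hy
    refine mul_le_mul_of_nonneg_left ?_ hp'.le
    have h := hle hy
    rw [hsum hx, hsum hy]
    simp only [hxg]
    rw [Finset.sum_const, Finset.card_univ, nsmul_eq_mul]
    rw [Fintype.card_fin] at h ⊢
    linarith
end

section
/- Let p ∈ (0,1], let {1,…,n} be partitioned into C nonempty clone groups, with c(i) denoting the group of index i and n_c the size of group c, and define the n×n matrix U by U_{ij} = n_{c(i)}^{−1/(p+1)} if c(i) = c(j) and U_{ij} = 0 otherwise. If x ∈ Δ^{n−1} satisfies Σ_{j : c(j)=c} x_j = 1/C for every group c, then the affinity entropy satisfies H_a^p(x) = (1/p)·[1 − Σ_{c=1}^C (1/C)^{p+1}] = (1/p)·(1 − C^{−p}), which is the Tsallis entropy of the uniform distribution over C elements. -/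
/-- With the clone-structured matrix `U` of Statement 5, if `x` in the
probability simplex places mass `1/C` on every clone group, then the affinity entropy equals
`(1/p)·(1 - ∑_{c=1}^C (1/C)^(p+1)) = (1/p)·(1 - C^(-p))`, the Tsallis entropy of the uniform
distribution over `C` elements. -/
theorem stmt_6 (n C : ℕ) (p : ℝ) (hp : p ∈ Set.Ioc (0 : ℝ) 1)
    (c : Fin n → Fin C) (hc : Function.Surjective c)
    (U : Fin n → Fin n → ℝ)
    (hUdef : ∀ i j, U i j =
      if c i = c j then
        (((Finset.univ.filter fun k => c k = c i).card : ℝ)) ^ (-(1 / (p + 1)))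
      else 0)
    (x : Fin n → ℝ) (hx : x ∈ stdSimplex ℝ (Fin n))
    (hmass : ∀ g : Fin C, ∑ j ∈ Finset.univ.filter fun j => c j = g, x j = 1 / (C : ℝ)) :
    (1 / p) * (1 - ∑ i, (∑ j, U i j * x j) ^ (p + 1)) =
      (1 / p) * (1 - ∑ _g : Fin C, (1 / (C : ℝ)) ^ (p + 1)) ∧
    (1 / p) * (1 - ∑ _g : Fin C, (1 / (C : ℝ)) ^ (p + 1)) =
      (1 / p) * (1 - (C : ℝ) ^ (-p)) := by
  obtain ⟨hp0, -⟩ := hp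
  have hp1 : p + 1 ≠ 0 := by linarith
  have hCpos : 0 < C := by
    rcases Nat.eq_zero_or_pos C with rfl | h
    · have : IsEmpty (Fin n) := Function.isEmpty c
      simpa using hx.2
    · exact h
  have hC : (0 : ℝ) < C := by exact_mod_cast hCpos
  have hrow : ∀ i, (∑ j, U i j * x j) ^ (p + 1) =
      ((Finset.univ.filter fun k => c k = c i).card : ℝ)⁻¹ * (1 / (C : ℝ)) ^ (p + 1) := by
    intro i
    have hlin : ∑ j, U i j * x j =
        ((Finset.univ.filter fun k => c k = c i).card : ℝ) ^ (-(1 / (p + 1))) *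
          (1 / (C : ℝ)) := by
      rw [← hmass (c i), Finset.mul_sum, Finset.sum_filter]
      refine Finset.sum_congr rfl fun j _ => ?_
      simp only [hUdef, ite_mul, zero_mul, eq_comm]
    rw [hlin, Real.mul_rpow (by positivity) (by positivity), ← Real.rpow_mul (by positivity),
      neg_mul, one_div_mul_cancel hp1, Real.rpow_neg_one]
  have hsum : ∑ i, (∑ j, U i j * x j) ^ (p + 1) =
      ∑ _g : Fin C, (1 / (C : ℝ)) ^ (p + 1) := by
    simp only [hrow]
    rw [← Finset.sum_fiberwise Finset.univ c]
    refine Finset.sum_congr rfl fun g _ => ?_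
    obtain ⟨i, hi⟩ := hc g
    have hcard : ((Finset.univ.filter fun k => c k = g).card : ℝ) ≠ 0 :=
      Nat.cast_ne_zero.mpr (Finset.card_ne_zero_of_mem (a := i) (by simp [hi]))
    rw [Finset.sum_congr rfl (g := fun _ =>
      ((Finset.univ.filter fun k => c k = g).card : ℝ)⁻¹ * (1 / (C : ℝ)) ^ (p + 1))
      fun j hj => by rw [(Finset.mem_filter.mp hj).2], Finset.sum_const, nsmul_eq_mul,
      mul_inv_cancel_left₀ hcard]
  refine ⟨by rw [hsum], ?_⟩
  rw [Finset.sum_const, Finset.card_univ, Fintype.card_fin, nsmul_eq_mul,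
    Real.rpow_add_one (by positivity), one_div (C : ℝ), Real.inv_rpow hC.le, ← Real.rpow_neg hC.le,
    mul_left_comm, mul_inv_cancel₀ hC.ne', mul_one]
end

section
/- Let p ∈ (0,1] and let U be a real m×n matrix with all entries nonnegative such that every column of U has (p+1)-norm exactly 1. Then the minimum over the probability simplex Δ^{n−1} of the affinity entropy H_a^p(x) = (1/p)·[1 − Σ_{i=1}^m ((Ux)_i)^{p+1}] equals 0, and it is attained at every vertex (standard basis vector) of the simplex. -/
/-- For `q ≥ 1`, if the `q`-th powers of the entries of each column of a nonnegative matrix sum to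
`1`, then those of any convex combination of the columns sum to at most `1`. -/
theorem sum_rpow_mulVec_le_one {ι κ : Type*} [Fintype ι] [Fintype κ] {q : ℝ} (hq : 1 ≤ q)
    {U : ι → κ → ℝ} (hU : ∀ i j, 0 ≤ U i j) (hcol : ∀ j, ∑ i, U i j ^ q = 1)
    {x : κ → ℝ} (hx : x ∈ stdSimplex ℝ κ) :
    ∑ i, (∑ j, U i j * x j) ^ q ≤ 1 := by
  calc ∑ i, (∑ j, U i j * x j) ^ q
      ≤ ∑ i, ∑ j, x j * U i j ^ q := by
        refine Finset.sum_le_sum fun i _ => ?_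
        simpa only [mul_comm] using Real.rpow_arith_mean_le_arith_mean_rpow Finset.univ x (U i)
          (fun j _ => hx.1 j) hx.2 (fun j _ => hU i j) hq
    _ = ∑ j, x j * ∑ i, U i j ^ q := by
        rw [Finset.sum_comm]
        simp only [Finset.mul_sum]
    _ = 1 := by simp only [hcol, mul_one, hx.2]


/-- Let `p ∈ (0,1]` and let `U` be a nonnegative real `m × n` matrix whose
columns all have `(p+1)`-norm exactly `1`. Then the minimum of the affinity entropy
`H_a^p(x) = (1/p)·(1 - ∑ i, ((Ux)_i)^(p+1))` over the probability simplex equals `0`, and it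
is attained at every vertex (standard basis vector) of the simplex. -/
theorem stmt_7 (m n : ℕ) (hn : 0 < n) (p : ℝ) (hp : p ∈ Set.Ioc (0 : ℝ) 1)
    (U : Fin m → Fin n → ℝ) (hU : ∀ i j, 0 ≤ U i j)
    (hcol : ∀ j, (∑ i, U i j ^ (p + 1)) ^ (1 / (p + 1)) = 1) :
    IsLeast {t : ℝ | ∃ x ∈ stdSimplex ℝ (Fin n),
        t = (1 / p) * (1 - ∑ i, (∑ j, U i j * x j) ^ (p + 1))} 0 ∧
    ∀ j : Fin n,
      (1 / p) * (1 - ∑ i, (∑ k, U i k * (if k = j then (1 : ℝ) else 0)) ^ (p + 1)) = 0 := by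
  have hp0 : 0 < p := hp.1
  have hsum : ∀ j, ∑ i, U i j ^ (p + 1) = 1 := fun j =>
    (Real.rpow_left_inj (Finset.sum_nonneg fun i _ => Real.rpow_nonneg (hU i j) _) zero_le_one
      (by positivity)).1 ((hcol j).trans (Real.one_rpow _).symm)
  have hvertex : ∀ j : Fin n,
      (1 / p) * (1 - ∑ i, (∑ k, U i k * (if k = j then (1 : ℝ) else 0)) ^ (p + 1)) = 0 := by
    intro j
    simp [hsum]
  refine ⟨⟨⟨fun k => if k = ⟨0, hn⟩ then 1 else 0, ⟨fun k => ?_, by simp⟩,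
    (hvertex ⟨0, hn⟩).symm⟩, ?_⟩, hvertex⟩
  · dsimp only
    split_ifs <;> norm_num
  · rintro _ ⟨x, hx, rfl⟩
    exact mul_nonneg (by positivity)
      (sub_nonneg.2 (sum_rpow_mulVec_le_one (by linarith) hU hsum hx))
end

section
/- Let K be an n×n matrix with strictly positive entries. For p > 0 define U^{(p)} = K·Λ_p^{−1}, where Λ_p is the diagonal matrix whose j-th diagonal entry is the (p+1)-norm of the j-th column of K, and let U^{(0)} = K·Λ_0^{−1} where Λ_0 has j-th diagonal entry equal to the column sum Σ_i K_{ij}. Then for every x in the probability simplex Δ^{n−1}, the limit as p → 0⁺ of the affinity entropy H_a^p(x) = (1/p)·[1 − Σ_{i=1}^n ((U^{(p)}x)_i)^{p+1}] exists and equals S(U^{(0)}x) − Σ_{j=1}^n [log(Σ_i K_{ij}) − Σ_i U^{(0)}_{ij}·log(K_{ij})]·x_j, where S(y) = −Σ_i y_i log y_i is the Shannon entropy. -/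
/-- The derivative at `p = 0` of the `(p + 1)`-norm of a positive vector. -/
theorem hasDerivAt_rpow_norm {n : ℕ} [NeZero n] (k : Fin n → ℝ) (hk : ∀ i, 0 < k i) :
    HasDerivAt (fun p : ℝ => (∑ i, k i ^ (p + 1)) ^ (1 / (p + 1)))
      (∑ i, k i * Real.log (k i) - (∑ i, k i) * Real.log (∑ i, k i)) 0 := by
  have hs : 0 < ∑ i, k i := Finset.sum_pos (fun i _ => hk i) Finset.univ_nonempty
  have hp : HasDerivAt (fun p : ℝ => p + 1) 1 0 := (hasDerivAt_id 0).add_const 1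
  have hsum : HasDerivAt (fun p : ℝ => ∑ i, k i ^ (p + 1)) (∑ i, k i * Real.log (k i)) 0 := by
    refine HasDerivAt.fun_sum fun i _ => ?_
    refine (hp.const_rpow (hk i)).congr_deriv ?_
    simp [mul_comm]
  have hinv : HasDerivAt (fun p : ℝ => 1 / (p + 1)) (-1) 0 := by
    simpa using hp.fun_inv (by norm_num)
  refine (hsum.rpow hinv (by simpa using hs)).congr_deriv ?_
  simp
  ring


/-- Let `K` be an `n × n` matrix with strictly positive entries. For `p > 0`
let `U^(p) i j = K i j / (∑ i', (K i' j)^(p+1))^(1/(p+1))` (column `(p+1)`-norm normalization)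
and `U^(0) i j = K i j / ∑ i', K i' j` (column-sum normalization). Then for every `x` in the
probability simplex, the affinity entropy `H_a^p(x)` tends, as `p → 0⁺`, to
`S(U^(0) x) - ∑ j, (log (∑ i, K i j) - ∑ i, U^(0) i j * log (K i j)) * x j`,
where `S(y) = -∑ i, y i * log (y i)` is the Shannon entropy. -/
theorem stmt_8 (n : ℕ) (K : Fin n → Fin n → ℝ) (hK : ∀ i j, 0 < K i j)
    (x : Fin n → ℝ) (hx : x ∈ stdSimplex ℝ (Fin n)) :
    Filter.Tendsto
      (fun p : ℝ => (1 / p) * (1 - ∑ i,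
        (∑ j, (K i j / (∑ i', K i' j ^ (p + 1)) ^ (1 / (p + 1))) * x j) ^ (p + 1)))
      (nhdsWithin 0 (Set.Ioi 0))
      (nhds
        ((-∑ i, (∑ j, (K i j / (∑ i', K i' j)) * x j) *
            Real.log (∑ j, (K i j / (∑ i', K i' j)) * x j)) -
          ∑ j, (Real.log (∑ i, K i j) -
            ∑ i, (K i j / (∑ i', K i' j)) * Real.log (K i j)) * x j)) := by
  obtain ⟨hx0, hx1⟩ := hx
  obtain ⟨j₀, -, hj₀⟩ : ∃ j ∈ Finset.univ, 0 < x j :=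
    by
    by_contra! h
    linarith [Finset.sum_nonpos h]
  have : NeZero n := ⟨by rintro rfl; exact j₀.elim0⟩
  have hs (j : Fin n) : 0 < ∑ i, K i j :=
    Finset.sum_pos (fun i _ => hK i j) Finset.univ_nonempty
  have hu (i : Fin n) : 0 < ∑ j, (K i j / (∑ i', K i' j)) * x j :=
    Finset.sum_pos' (fun j _ => mul_nonneg (div_pos (hK i j) (hs j)).le (hx0 j))
      ⟨j₀, Finset.mem_univ _, mul_pos (div_pos (hK i j₀) (hs j₀)) hj₀⟩
  have hp : HasDerivAt (fun p : ℝ => p + 1) 1 0 := (hasDerivAt_id 0).add_const 1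
  have hcol (i : Fin n) : HasDerivAt
      (fun p : ℝ => ∑ j, (K i j / (∑ i', K i' j ^ (p + 1)) ^ (1 / (p + 1))) * x j)
      (∑ j, (K i j / (∑ i', K i' j)) * (Real.log (∑ i', K i' j) -
        ∑ i', (K i' j / (∑ i', K i' j)) * Real.log (K i' j)) * x j) 0 := by
    refine HasDerivAt.fun_sum fun j _ => HasDerivAt.mul_const ?_ (x j)
    have hne : (∑ i', K i' j) ≠ 0 := (hs j).ne'
    have hN := hasDerivAt_rpow_norm (fun i' => K i' j) (fun i' => hK i' j)
    have hmean : ∑ i', (K i' j / (∑ i', K i' j)) * Real.log (K i' j) =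
        (∑ i', K i' j * Real.log (K i' j)) / ∑ i', K i' j := by
      rw [Finset.sum_div]
      exact Finset.sum_congr rfl fun i' _ => by ring
    rw [hmean]
    refine ((hasDerivAt_const (0 : ℝ) (K i j)).fun_div hN (by simpa using hne)).congr_deriv ?_
    simp only [zero_add, Real.rpow_one, div_one]
    field_simp
    ring
  have hF := HasDerivAt.fun_sum fun i (_ : i ∈ Finset.univ) =>
    (hcol i).rpow hp (by simpa using hu i)
  have hswap : ∑ i, ∑ j, (K i j / (∑ i', K i' j)) * (Real.log (∑ i', K i' j) -
        ∑ i', (K i' j / (∑ i', K i' j)) * Real.log (K i' j)) * x j =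
      ∑ j, (Real.log (∑ i, K i j) -
        ∑ i, (K i j / (∑ i', K i' j)) * Real.log (K i j)) * x j := by
    rw [Finset.sum_comm]
    refine Finset.sum_congr rfl fun j _ => ?_
    simp_rw [mul_assoc]
    rw [← Finset.sum_mul, ← Finset.sum_div, div_self (hs j).ne', one_mul]
  have hmass : ∑ i, ∑ j, (K i j / (∑ i', K i' j)) * x j = 1 := by
    rw [Finset.sum_comm, ← hx1]
    refine Finset.sum_congr rfl fun j _ => ?_
    rw [← Finset.sum_mul, ← Finset.sum_div, div_self (hs j).ne', one_mul]
  have hslope := ((hasDerivWithinAt_iff_tendsto_slope' (by simp)).1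
    (hF.hasDerivWithinAt (s := Set.Ioi 0))).neg
  simp only [zero_add, Real.rpow_one, div_one, sub_self, Real.rpow_zero, mul_one, one_mul,
    Finset.sum_add_distrib, hswap] at hslope
  convert hslope using 2 with p
  · simp only [slope, vsub_eq_sub, smul_eq_mul, zero_add, Real.rpow_one, div_one, sub_zero, hmass]
    ring
  · ring
end

section
/- Consider an n-player finite normal-form game with action sets A_1,…,A_n and utility functions u_1,…,u_n, and fix a player i with two actions p, q ∈ A_i. For each j ≠ i let d_j = |A_j|, identify A_j with the coordinates of the simplex T^{d_j} = {x ∈ ℝ^{d_j} : x ≥ 0, Σ x ≤ 1}, and let the strategies x_j be drawn independently and uniformly from T^{d_j}. Let r_p(x_{−i}) = Σ_{a_{−i}∈A_{−i}} u_i(p, a_{−i})·Π_{j≠i} x_{j,a_j}, and similarly r_q. Then E[(r_p − r_q)²] = (Π_{j≠i} 1/((d_j+1)(d_j+2))) · Σ_{a_{−i}∈A_{−i}} Σ_{a'_{−i}∈A_{−i}} (u_i(p,a_{−i}) − u_i(q,a_{−i}))·(u_i(p,a'_{−i}) − u_i(q,a'_{−i}))·2^{#{j≠i : a_j = a'_j}}.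 -/
open MeasureTheory ENNReal

/-- Euler's beta integral on `[0, s]` for natural exponents. -/
theorem integral_pow_mul_sub_pow (a M : ℕ) (s : ℝ) :
    ∫ t in (0 : ℝ)..s, t ^ a * (s - t) ^ M =
      (a.factorial * M.factorial : ℝ) / ((a + M + 1).factorial : ℝ) * s ^ (a + M + 1) := by
  induction a generalizing M with
  | zero =>
    have h := intervalIntegral.integral_comp_sub_left (a := 0) (b := s) (fun t : ℝ => t ^ M) s
    simp only [pow_zero, one_mul, zero_add, h, sub_self, sub_zero, integral_pow,
      Nat.factorial_succ]
    have := Nat.factorial_pos M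
    push_cast
    field_simp
    simp
  | succ a ih =>
    have hderiv : ∀ t : ℝ, HasDerivAt (fun t : ℝ => t ^ (a + 1) * (s - t) ^ (M + 1))
        ((a + 1 : ℝ) * (t ^ a * (s - t) ^ (M + 1)) - (M + 1 : ℝ) * (t ^ (a + 1) * (s - t) ^ M))
        t := by
      intro t
      have h := (hasDerivAt_pow (a + 1) t).mul
        (((hasDerivAt_id t).const_sub s).pow (M + 1))
      refine h.congr_deriv ?_
      simp
      ring
    have hFTC := intervalIntegral.integral_eq_sub_of_hasDerivAt (a := 0) (b := s)
      (fun t _ => hderiv t) (Continuous.intervalIntegrable (by fun_prop) _ _)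
    rw [intervalIntegral.integral_sub (Continuous.intervalIntegrable (by fun_prop) _ _)
      (Continuous.intervalIntegrable (by fun_prop) _ _), intervalIntegral.integral_const_mul,
      intervalIntegral.integral_const_mul, ih (M + 1)] at hFTC
    have hM : (M + 1 : ℝ) ≠ 0 := by positivity
    apply mul_left_cancel₀ hM
    simp only [sub_self, ne_eq, Nat.succ_ne_zero, not_false_eq_true, zero_pow, mul_zero,
      zero_mul] at hFTC
    rw [← sub_eq_zero.mp hFTC]
    rw [show a + (M + 1) + 1 = a + 1 + M + 1 by ring, Nat.factorial_succ a, Nat.factorial_succ M]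
    push_cast
    ring

/-- The simplex of nonnegative vectors of `Fin n → ℝ` whose coordinates sum to at most `s`. -/
def subsimplex (n : ℕ) (s : ℝ) : Set (Fin n → ℝ) :=
  {y | (∀ k, 0 ≤ y k) ∧ ∑ k, y k ≤ s}

theorem isCompact_subsimplex (n : ℕ) (s : ℝ) : IsCompact (subsimplex n s) := by
  refine (isCompact_Icc (a := (0 : Fin n → ℝ)) (b := fun _ => s)).of_isClosed_subset ?_ ?_
  · simp only [subsimplex, Set.ofPred_and, Set.ofPred_forall]
    exact (isClosed_iInter fun k => isClosed_le continuous_const (continuous_apply k)).inter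
      (isClosed_le (by fun_prop) continuous_const)
  · exact fun y hy => ⟨hy.1, fun k =>
      (Finset.single_le_sum (fun j _ => hy.1 j) (Finset.mem_univ k)).trans hy.2⟩

theorem cons_mem_subsimplex {n : ℕ} {s t : ℝ} {y : Fin n → ℝ} :
    (Fin.cons t y : Fin (n + 1) → ℝ) ∈ subsimplex (n + 1) s ↔
      0 ≤ t ∧ y ∈ subsimplex n (s - t) := by
  simp [subsimplex, Fin.forall_fin_succ, Fin.sum_univ_succ, and_assoc, le_sub_iff_add_le']

theorem subsimplex_of_neg {n : ℕ} {s : ℝ} (hs : s < 0) : subsimplex n s = ∅ :=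
  Set.eq_empty_of_forall_notMem fun _ hy =>
    (hs.trans_le (Finset.sum_nonneg fun k _ => hy.1 k)).not_ge hy.2

/-- Dirichlet's integral of a monomial over a simplex. -/
theorem integral_subsimplex_monomial (n : ℕ) (α : Fin n → ℕ) {s : ℝ} (hs : 0 ≤ s) :
    ∫ y in subsimplex n s, ∏ k, y k ^ α k =
      (∏ k, ((α k).factorial : ℝ)) / ((n + ∑ k, α k).factorial : ℝ) * s ^ (n + ∑ k, α k) := by
  induction n generalizing s with
  | zero =>
    have : subsimplex 0 s = Set.univ := by ext; simp [subsimplex, hs]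
    simp [this, measureReal_def, volume_pi]
  | succ n ih =>
    have hmeas (m : ℕ) (r : ℝ) : MeasurableSet (subsimplex m r) :=
      (isCompact_subsimplex m r).isClosed.measurableSet
    have hint : Integrable ((subsimplex (n + 1) s).indicator fun y => ∏ k, y k ^ α k) :=
      (integrable_indicator_iff (hmeas _ _)).2
        (ContinuousOn.integrableOn_compact (isCompact_subsimplex _ _) (by fun_prop))
    have hmp := (volume_preserving_piFinSuccAbove (fun _ : Fin (n + 1) => ℝ) 0).symm
    have hfun : ∀ z : ℝ × (Fin n → ℝ), (subsimplex (n + 1) s).indicator (fun y => ∏ k, y k ^ α k)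
        ((MeasurableEquiv.piFinSuccAbove (fun _ : Fin (n + 1) => ℝ) 0).symm z) =
        (Set.Icc 0 s).indicator (fun t => t ^ α 0 *
          (subsimplex n (s - t)).indicator (fun y => ∏ k, y k ^ α k.succ) z.2) z.1 := by
      rintro ⟨t, y⟩
      have hcons : (MeasurableEquiv.piFinSuccAbove (fun _ : Fin (n + 1) => ℝ) 0).symm (t, y) =
          Fin.cons t y := by
        simp [MeasurableEquiv.piFinSuccAbove_symm_apply, Fin.consEquiv]
      rw [hcons]
      by_cases ht : t ∈ Set.Icc 0 s
      · rw [Set.indicator_of_mem ht]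
        by_cases hy : y ∈ subsimplex n (s - t)
        · rw [Set.indicator_of_mem hy, Set.indicator_of_mem (cons_mem_subsimplex.2 ⟨ht.1, hy⟩)]
          simp [Fin.prod_univ_succ]
        · rw [Set.indicator_of_notMem hy, mul_zero,
            Set.indicator_of_notMem fun h => hy (cons_mem_subsimplex.1 h).2]
      · rw [Set.indicator_of_notMem ht, Set.indicator_of_notMem]
        rw [cons_mem_subsimplex]
        rintro ⟨h0, hy⟩
        have : s - t < 0 := by
          by_contra! h
          exact ht ⟨h0, by linarith⟩
        simp [subsimplex_of_neg this] at hy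
    rw [← integral_indicator (hmeas _ _), ← hmp.integral_comp']
    rw [← hmp.integrable_comp_emb (MeasurableEquiv.measurableEmbedding _)] at hint
    rw [Measure.volume_eq_prod] at hint ⊢
    simp only [Function.comp_def, hfun] at hint ⊢
    rw [integral_prod _ hint]
    have hinner : ∀ t : ℝ, ∫ y : Fin n → ℝ, (Set.Icc 0 s).indicator (fun t => t ^ α 0 *
          (subsimplex n (s - t)).indicator (fun y => ∏ k, y k ^ α k.succ) y) t =
        (Set.Icc 0 s).indicator (fun t => (∏ k : Fin n, ((α k.succ).factorial : ℝ)) /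
          ((n + ∑ k : Fin n, α k.succ).factorial : ℝ) *
          (t ^ α 0 * (s - t) ^ (n + ∑ k : Fin n, α k.succ))) t := by
      intro t
      by_cases ht : t ∈ Set.Icc 0 s
      · simp only [Set.indicator_of_mem ht]
        rw [integral_const_mul, integral_indicator (hmeas _ _),
          ih (fun k => α k.succ) (sub_nonneg.2 ht.2)]
        ring
      · simp [Set.indicator_of_notMem ht]
    simp only [hinner]
    rw [integral_indicator measurableSet_Icc, integral_Icc_eq_integral_Ioc,
      ← intervalIntegral.integral_of_le hs, intervalIntegral.integral_const_mul,
      integral_pow_mul_sub_pow, Fin.prod_univ_succ, Fin.sum_univ_succ,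
      show n + 1 + (α 0 + ∑ k : Fin n, α k.succ) = α 0 + (n + ∑ k : Fin n, α k.succ) + 1 by ring]
    have := Nat.factorial_pos (n + ∑ k : Fin n, α k.succ)
    field_simp

/-- The second moments of the uniform distribution on the standard simplex. -/
theorem integral_uniform_subsimplex_mul (n : ℕ) (k l : Fin n) :
    ∫ y, y k * y l ∂((n.factorial : ℝ≥0∞) • volume.restrict (subsimplex n 1)) =
      1 / (((n : ℝ) + 1) * ((n : ℝ) + 2)) * (if k = l then 2 else 1) := by
  set α : Fin n → ℕ := fun j => (if j = k then 1 else 0) + (if j = l then 1 else 0) with hα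
  have hmon : ∀ y : Fin n → ℝ, y k * y l = ∏ j, y j ^ α j := fun y => by
    simp only [hα, pow_add, Finset.prod_mul_distrib, pow_ite, pow_one, pow_zero]
    simp
  have hsum : ∑ j, α j = 2 := by simp [hα, Finset.sum_add_distrib]
  have hprod : ∏ j, ((α j).factorial : ℝ) = if k = l then 2 else 1 := by
    split_ifs with h
    · subst h
      rw [Finset.prod_eq_single k (fun j _ hj => by simp [hα, hj]) (by simp)]
      simp [hα]
    · refine Finset.prod_eq_one fun j _ => ?_
      by_cases hk : j = k
      · simp [hα, hk, h]
      · by_cases hl : j = l <;> simp [hα, hk, hl, Ne.symm h]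
  rw [integral_smul_measure]
  simp only [hmon]
  rw [integral_subsimplex_monomial n α zero_le_one, hsum, hprod, Nat.factorial_succ,
    Nat.factorial_succ]
  have := Nat.factorial_pos n
  simp only [toReal_natCast, smul_eq_mul, one_pow, mul_one]
  push_cast
  field_simp
  ring

/-- Fix a player `i` of a finite normal-form game with two of its actions
`p, q`. The opponents are indexed by a finite type `ι` (the players `j ≠ i`), player `j`
having `d j` actions identified with the coordinates of the simplex `T^{d j}`. The opponents'
strategies `x j` are drawn independently and uniformly from `T^{d j}` (uniform distribution
`= (d j)! • volume` restricted to the simplex). With ratings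
`r_p(x) = ∑_{a_{-i}} u_i(p, a_{-i}) ∏_j x_{j, a_j}`, the expected squared rating difference is
`E[(r_p - r_q)²] = (∏_j 1/((d_j+1)(d_j+2))) · ∑_{a_{-i}} ∑_{a'_{-i}}
  (u_i(p,a_{-i}) - u_i(q,a_{-i}))(u_i(p,a'_{-i}) - u_i(q,a'_{-i})) · 2^{#{j : a_j = a'_j}}`. -/
theorem stmt_13 (ι : Type*) [Fintype ι] [DecidableEq ι] (d : ι → ℕ) (m : ℕ)
    (u : Fin m → (∀ j, Fin (d j)) → ℝ) (p q : Fin m) :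
    (∫ x : ∀ j, Fin (d j) → ℝ,
        ((∑ a : ∀ j, Fin (d j), u p a * ∏ j, x j (a j)) -
          (∑ a : ∀ j, Fin (d j), u q a * ∏ j, x j (a j))) ^ 2
      ∂(Measure.pi fun j => (Nat.factorial (d j) : ℝ≥0∞) •
          (volume.restrict {y : Fin (d j) → ℝ | (∀ k, 0 ≤ y k) ∧ ∑ k, y k ≤ 1}))) =
      (∏ j, (1 : ℝ) / (((d j : ℝ) + 1) * ((d j : ℝ) + 2))) *
        ∑ a : ∀ j, Fin (d j), ∑ a' : ∀ j, Fin (d j),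
          (u p a - u q a) * (u p a' - u q a') *
            (2 : ℝ) ^ (Finset.univ.filter fun j => a j = a' j).card := by
  set μ : ∀ j, Measure (Fin (d j) → ℝ) := fun j =>
    (Nat.factorial (d j) : ℝ≥0∞) • volume.restrict (subsimplex (d j) 1) with hμ
  change ∫ x : ∀ j, Fin (d j) → ℝ, _ ∂(Measure.pi μ) = _
  have hfin : ∀ j, IsFiniteMeasure (μ j) := fun j => by
    have : IsFiniteMeasure (volume.restrict (subsimplex (d j) 1)) :=
      isFiniteMeasure_restrict.2 (isCompact_subsimplex _ _).measure_ne_top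
    exact Measure.smul_finite _ (natCast_ne_top _)
  have hint : ∀ a a' : ∀ j, Fin (d j),
      Integrable (fun x : ∀ j, Fin (d j) → ℝ => ∏ j, x j (a j) * x j (a' j)) (Measure.pi μ) := by
    intro a a'
    refine Integrable.fintype_prod_dep (f := fun j (y : Fin (d j) → ℝ) => y (a j) * y (a' j)) fun j => ?_
    have h : IntegrableOn (fun y : Fin (d j) → ℝ => y (a j) * y (a' j)) (subsimplex (d j) 1) :=
      ContinuousOn.integrableOn_compact (isCompact_subsimplex _ _) (by fun_prop)
    exact h.smul_measure (natCast_ne_top _)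
  have hexpand : ∀ x : ∀ j, Fin (d j) → ℝ,
      ((∑ a : ∀ j, Fin (d j), u p a * ∏ j, x j (a j)) -
          (∑ a : ∀ j, Fin (d j), u q a * ∏ j, x j (a j))) ^ 2 =
        ∑ a : ∀ j, Fin (d j), ∑ a' : ∀ j, Fin (d j),
          (u p a - u q a) * (u p a' - u q a') * ∏ j, x j (a j) * x j (a' j) := by
    intro x
    simp only [← Finset.sum_sub_distrib, sq, Finset.sum_mul_sum, Finset.prod_mul_distrib]
    exact Finset.sum_congr rfl fun a _ => Finset.sum_congr rfl fun a' _ => by ring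
  simp only [hexpand]
  rw [integral_finsetSum _ fun a _ => integrable_finsetSum _ fun a' _ => (hint a a').const_mul _,
    Finset.mul_sum]
  refine Finset.sum_congr rfl fun a _ => ?_
  rw [integral_finsetSum _ fun a' _ => (hint a a').const_mul _, Finset.mul_sum]
  refine Finset.sum_congr rfl fun a' _ => ?_
  rw [integral_const_mul,
    integral_fintype_prod_eq_prod (fun j (y : Fin (d j) → ℝ) => y (a j) * y (a' j))]
  simp only [hμ, integral_uniform_subsimplex_mul, Finset.prod_mul_distrib]
  rw [Finset.prod_ite, Finset.prod_const, Finset.prod_const_one, mul_one]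
  ring
end

section
/- In the cloned Chicken game (where each player's action set is {Swerve, Straight₁, Straight₂} and both Straight actions are payoff-identical clones of Straight), the following hold: (i) the symmetric profile A in which each player plays (11/12, 1/24, 1/24) is a Nash equilibrium; (ii) the profile B in which player 1 plays Swerve and player 2 plays (0, 1/2, 1/2) is a Nash equilibrium; and (iii) the sum of the Shannon entropies of the two players' strategies in profile A, namely 2·[−(11/12)·log(11/12) − 2·(1/24)·log(1/24)], is strictly less than the corresponding sum log 2 in profile B. -/
open Finset

/-- Payoff matrix of player 1 in the cloned Chicken game: action `0` is Swerve, actions `1`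
and `2` are the two payoff-identical Straight clones. -/
def clonedChickenU1 : Fin 3 → Fin 3 → ℝ := ![![0, -1, -1], ![1, -12, -12], ![1, -12, -12]]

/-- Payoff matrix of player 2 in the cloned Chicken game (symmetric game). -/
def clonedChickenU2 : Fin 3 → Fin 3 → ℝ := fun s t => clonedChickenU1 t s

/-- Expected payoff to player 1 under mixed strategies `x` and `y`. -/
def clonedChickenPayoff1 (x y : Fin 3 → ℝ) : ℝ := ∑ s, ∑ t, x s * y t * clonedChickenU1 s t

/-- Expected payoff to player 2 under mixed strategies `x` and `y`. -/
def clonedChickenPayoff2 (x y : Fin 3 → ℝ) : ℝ := ∑ s, ∑ t, x s * y t * clonedChickenU2 s t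

/-- `(x, y)` is a (mixed) Nash equilibrium of the cloned Chicken game. -/
def clonedChickenIsNash (x y : Fin 3 → ℝ) : Prop :=
  x ∈ stdSimplex ℝ (Fin 3) ∧ y ∈ stdSimplex ℝ (Fin 3) ∧
    (∀ x' ∈ stdSimplex ℝ (Fin 3), clonedChickenPayoff1 x' y ≤ clonedChickenPayoff1 x y) ∧
    (∀ y' ∈ stdSimplex ℝ (Fin 3), clonedChickenPayoff2 x y' ≤ clonedChickenPayoff2 x y)

/-- Three nonnegative reals summing to one form a point of the standard simplex. -/
theorem vec_mem_stdSimplex {a b c : ℝ} (ha : 0 ≤ a) (hb : 0 ≤ b) (hc : 0 ≤ c)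
    (habc : a + b + c = 1) : ![a, b, c] ∈ stdSimplex ℝ (Fin 3) := by
  refine ⟨fun i => ?_, ?_⟩
  · fin_cases i <;> assumption
  · rw [Fin.sum_univ_three]
    exact habc

/-- In the cloned Chicken game: (i) the symmetric profile `A` where each
player plays `(11/12, 1/24, 1/24)` is a Nash equilibrium; (ii) the profile `B` where player 1
plays Swerve and player 2 plays `(0, 1/2, 1/2)` is a Nash equilibrium; and (iii) the sum of
the Shannon entropies of the two strategies in `A`, namely
`2·(-(11/12)·log(11/12) - 2·(1/24)·log(1/24))`, is strictly less than the corresponding sum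
`log 2` in `B`. -/
theorem stmt_16 :
    clonedChickenIsNash ![11 / 12, 1 / 24, 1 / 24] ![11 / 12, 1 / 24, 1 / 24] ∧
    clonedChickenIsNash ![1, 0, 0] ![0, 1 / 2, 1 / 2] ∧
    2 * (-(11 / 12) * Real.log (11 / 12) - 2 * ((1 / 24) * Real.log (1 / 24))) <
      Real.log 2 := by
  refine ⟨⟨?_, ?_, ?_, ?_⟩, ⟨?_, ?_, ?_, ?_⟩, ?_⟩
  · exact vec_mem_stdSimplex (by norm_num) (by norm_num) (by norm_num) (by norm_num)
  · exact vec_mem_stdSimplex (by norm_num) (by norm_num) (by norm_num) (by norm_num)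
  · rintro x ⟨-, hsum⟩
    simp [clonedChickenPayoff1, clonedChickenU1, Fin.sum_univ_three] at hsum ⊢
    linarith
  · rintro y ⟨-, hsum⟩
    simp [clonedChickenPayoff2, clonedChickenU2, clonedChickenU1, Fin.sum_univ_three] at hsum ⊢
    linarith
  · exact vec_mem_stdSimplex (by norm_num) (by norm_num) (by norm_num) (by norm_num)
  · exact vec_mem_stdSimplex (by norm_num) (by norm_num) (by norm_num) (by norm_num)
  · rintro x ⟨hnonneg, hsum⟩
    have h₁ := hnonneg 1
    have h₂ := hnonneg 2
    simp [clonedChickenPayoff1, clonedChickenU1, Fin.sum_univ_three] at hsum ⊢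
    linarith
  · rintro y ⟨hnonneg, hsum⟩
    have h₀ := hnonneg 0
    simp [clonedChickenPayoff2, clonedChickenU2, clonedChickenU1, Fin.sum_univ_three] at hsum ⊢
    linarith
  · have h : Real.log ((12 : ℝ) ^ 11 * 24) < Real.log (2 ^ 6 * 11 ^ 11) :=
      Real.log_lt_log (by norm_num) (by norm_num)
    rw [Real.log_mul (by norm_num) (by norm_num), Real.log_mul (by norm_num) (by norm_num),
      Real.log_pow, Real.log_pow, Real.log_pow] at h
    rw [Real.log_div (by norm_num) (by norm_num), one_div, Real.log_inv]
    push_cast at h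
    linarith
end
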